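/- arXiv:2001.08737 — 2 statements merged into one kernel-verified Lean document; each statement's English description precedes it below -/
import Mathlib

section
/- Let (a_t)_{t≥1} and (c_t)_{t≥1} be sequences of nonnegative real numbers such that for every t ≥ 1, a_{t+1} ≤ (1 − 2/t) a_t + c_t/t². Then for every T ≥ 1, a_{T+1} ≤ (1/T²) Σ_{t=1}^{T} c_t. -/
/-- The weighted terms `T² a_{T+1}` grow by at most `c_{T+1}` at each step, since
`t (t - 2) ≤ (t - 1)²`. -/
theorem sq_mul_le_sum_of_recursion (a c : ℕ → ℝ) (ha : ∀ t, 0 ≤ a t)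
    (hrec : ∀ t, 1 ≤ t →
      a (t + 1) ≤ (1 - 2 / (t : ℝ)) * a t + c t / (t : ℝ) ^ 2) (T : ℕ) :
    (T : ℝ) ^ 2 * a (T + 1) ≤ ∑ t ∈ Finset.Icc 1 T, c t := by
  induction T with
  | zero => simp
  | succ n ih =>
    rw [Finset.sum_Icc_succ_top (by omega)]
    have hstep := mul_le_mul_of_nonneg_left (hrec (n + 1) (by omega))
      (sq_nonneg ((n + 1 : ℕ) : ℝ))
    have hexpand : ((n + 1 : ℕ) : ℝ) ^ 2 * ((1 - 2 / ((n + 1 : ℕ) : ℝ)) * a (n + 1) +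
        c (n + 1) / ((n + 1 : ℕ) : ℝ) ^ 2) =
        (((n + 1 : ℕ) : ℝ) ^ 2 - 2 * ((n + 1 : ℕ) : ℝ)) * a (n + 1) + c (n + 1) := by
      field_simp
    rw [hexpand] at hstep
    push_cast at hstep ⊢
    linarith [ha (n + 1)]

/-- Deterministic recursion lemma for SGD with learning rate `1/(λt)`: if
`a_{t+1} ≤ (1 - 2/t) a_t + c_t/t²` for all `t ≥ 1`, with `a_t, c_t ≥ 0`, then
`a_{T+1} ≤ (1/T²) Σ_{t=1}^T c_t` for every `T ≥ 1`. -/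
theorem sgd_recursion_lemma
    (a c : ℕ → ℝ) (ha : ∀ t, 0 ≤ a t) (hc : ∀ t, 0 ≤ c t)
    (hrec : ∀ t, 1 ≤ t →
      a (t + 1) ≤ (1 - 2 / (t : ℝ)) * a t + c t / (t : ℝ) ^ 2) :
    ∀ T, 1 ≤ T → a (T + 1) ≤ (1 / (T : ℝ) ^ 2) * ∑ t ∈ Finset.Icc 1 T, c t := by
  intro T hT
  have hpos : (0 : ℝ) < (T : ℝ) ^ 2 := by positivity
  rw [one_div_mul_eq_div, le_div_iff₀ hpos, mul_comm]
  exact sq_mul_le_sum_of_recursion a c ha hrec T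
end

section
/- Let ℓ : ℝ^d → ℝ be differentiable and λ-strongly convex with λ > 0 and global minimizer w*. On a probability space with a filtration (ℱ_t)_{t≥1}, let (w_t)_{t≥1} be iterates with w_1 deterministic and w_{t+1} = w_t − η_t ĝ_t, where η_t = 1/(λt), w_t is ℱ_t-measurable, and ĝ_t is a random vector satisfying E[ĝ_t | ℱ_t] = ∇ℓ(w_t) and E[‖ĝ_t‖² | ℱ_t] ≤ G_t² almost surely for deterministic constants G_t. Then for every T ≥ 1, E[‖w_{T+1} − w*‖²] ≤ (4/(λ²T²)) Σ_{t=1}^{T} G_t². -/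
open MeasureTheory
open scoped RealInnerProductSpace

section Helpers

variable {Ω E : Type*} {m mΩ : MeasurableSpace Ω} {μ : Measure Ω}
  [NormedAddCommGroup E] [InnerProductSpace ℝ E]

theorem MeasureTheory.MemLp.integrable_real_inner {f g : Ω → E}
    (hf : MemLp f 2 μ) (hg : MemLp g 2 μ) : Integrable (fun ω => ⟪f ω, g ω⟫) μ := by
  refine (hf.norm.integrable_mul hg.norm).mono' (hf.1.inner hg.1) (.of_forall fun ω => ?_)
  exact norm_inner_le_norm (f ω) (g ω)

theorem condExp_real_inner_of_stronglyMeasurable_left [CompleteSpace E] {f g : Ω → E}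
    (hf : StronglyMeasurable[m] f) (hfg : Integrable (fun ω => ⟪f ω, g ω⟫) μ)
    (hg : Integrable g μ) :
    μ[fun ω => ⟪f ω, g ω⟫ | m] =ᵐ[μ] fun ω => ⟪f ω, (μ[g | m]) ω⟫ :=
  condExp_bilin_of_stronglyMeasurable_left (innerSL ℝ) hf hfg hg

theorem integral_norm_sub_smul_sq {f g : Ω → E} (hf : MemLp f 2 μ) (hg : MemLp g 2 μ) (η : ℝ) :
    ∫ ω, ‖f ω - η • g ω‖ ^ 2 ∂μ =
      ∫ ω, ‖f ω‖ ^ 2 ∂μ - 2 * η * ∫ ω, ⟪f ω, g ω⟫ ∂μ + η ^ 2 * ∫ ω, ‖g ω‖ ^ 2 ∂μ := by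
  have hfi := (memLp_two_iff_integrable_sq_norm hf.1).1 hf
  have hgi := (memLp_two_iff_integrable_sq_norm hg.1).1 hg
  have hfg := hf.integrable_real_inner hg
  have hsub : Integrable (fun ω => ‖f ω‖ ^ 2 - 2 * η * ⟪f ω, g ω⟫) μ := hfi.sub (hfg.const_mul _)
  rw [← integral_const_mul, ← integral_const_mul, ← integral_sub hfi (hfg.const_mul _),
    ← integral_add hsub (hgi.const_mul _)]
  congr with ω
  rw [norm_sub_sq_real, real_inner_smul_right, norm_smul, mul_pow, Real.norm_eq_abs, sq_abs]
  ring

/-- One step of stochastic gradient descent: if the conditional mean of `g` is `lam`-strongly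
aligned with `f` and the conditional second moment of `g` is at most `C`, then the step `-η g`
contracts the second moment of `f` by `1 - 2 η lam`, up to an error `η ^ 2 C`. -/
theorem integral_norm_sub_smul_sq_le [CompleteSpace E] [IsProbabilityMeasure μ] (hm : m ≤ mΩ)
    {f g : Ω → E} (hf : StronglyMeasurable[m] f) (hf2 : MemLp f 2 μ) (hg2 : MemLp g 2 μ)
    {η lam C : ℝ} (hη : 0 ≤ η)
    (halign : ∀ᵐ ω ∂μ, lam * ‖f ω‖ ^ 2 ≤ ⟪f ω, (μ[g | m]) ω⟫)
    (hC : ∀ᵐ ω ∂μ, (μ[fun ω' => ‖g ω'‖ ^ 2 | m]) ω ≤ C) :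
    ∫ ω, ‖f ω - η • g ω‖ ^ 2 ∂μ ≤ (1 - 2 * η * lam) * ∫ ω, ‖f ω‖ ^ 2 ∂μ + η ^ 2 * C := by
  have hfi := (memLp_two_iff_integrable_sq_norm hf2.1).1 hf2
  have hfg := hf2.integrable_real_inner hg2
  have hinner : lam * ∫ ω, ‖f ω‖ ^ 2 ∂μ ≤ ∫ ω, ⟪f ω, g ω⟫ ∂μ := by
    rw [← integral_condExp hm (f := fun ω => ⟪f ω, g ω⟫), ← integral_const_mul]
    refine integral_mono_ae (hfi.const_mul _) integrable_condExp ?_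
    filter_upwards [halign, condExp_real_inner_of_stronglyMeasurable_left hf hfg
      (hg2.integrable one_le_two)] with ω h h'
    rwa [h']
  have hsq : ∫ ω, ‖g ω‖ ^ 2 ∂μ ≤ C := by
    rw [← integral_condExp hm (f := fun ω => ‖g ω‖ ^ 2)]
    simpa using integral_mono_ae integrable_condExp (integrable_const C) hC
  rw [integral_norm_sub_smul_sq hf2 hg2]
  nlinarith [mul_le_mul_of_nonneg_left hinner hη, mul_le_mul_of_nonneg_left hsq (sq_nonneg η)]

/-- A strongly convex function satisfies the restricted secant inequality at its minimizer. -/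
theorem mul_norm_sub_sq_le_inner_gradient [CompleteSpace E] {ℓ : E → ℝ} {lam : ℝ}
    (hsc : ∀ u v : E, ℓ u + ⟪gradient ℓ u, v - u⟫ + lam / 2 * ‖v - u‖ ^ 2 ≤ ℓ v)
    {x₀ : E} (hmin : ∀ x, ℓ x₀ ≤ ℓ x) (x : E) :
    lam * ‖x - x₀‖ ^ 2 ≤ ⟪x - x₀, gradient ℓ x⟫ := by
  have hgrad : gradient ℓ x₀ = 0 := by
    have : IsLocalMin ℓ x₀ := .of_forall hmin
    rw [gradient, this.fderiv_eq_zero, map_zero]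
  have h₁ := hsc x₀ x
  have h₂ := hsc x x₀
  rw [hgrad, inner_zero_left] at h₁
  rw [← neg_sub x x₀, inner_neg_right, norm_neg, real_inner_comm] at h₂
  linarith

end Helpers

/-- SGD with learning rate `η_t = 1/(λt)` on a `λ`-strongly convex function,
with conditionally unbiased stochastic gradients whose conditional second
moments are bounded by `G_t²`:
`E[‖w_{T+1} - w*‖²] ≤ (4/(λ²T²)) Σ_{t=1}^T G_t²` for every `T ≥ 1`. -/
theorem sgd_iterate_distance_bound
    {Ω : Type*} {mΩ : MeasurableSpace Ω} (μ : Measure Ω) [IsProbabilityMeasure μ]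
    (d : ℕ) (ℓ : EuclideanSpace ℝ (Fin d) → ℝ)
    (lam : ℝ) (hlam : 0 < lam)
    (hdiff : Differentiable ℝ ℓ)
    (hsc : ∀ u v : EuclideanSpace ℝ (Fin d),
      ℓ u + ⟪gradient ℓ u, v - u⟫ + lam / 2 * ‖v - u‖ ^ 2 ≤ ℓ v)
    (wstar : EuclideanSpace ℝ (Fin d)) (hmin : ∀ w, ℓ wstar ≤ ℓ w)
    (ℱ : Filtration ℕ mΩ)
    (w ghat : ℕ → Ω → EuclideanSpace ℝ (Fin d))
    (w₁ : EuclideanSpace ℝ (Fin d)) (hw₁ : ∀ ω, w 1 ω = w₁)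
    (hupdate : ∀ t, 1 ≤ t → ∀ ω,
      w (t + 1) ω = w t ω - (1 / (lam * t)) • ghat t ω)
    (hadapted : ∀ t, 1 ≤ t → StronglyMeasurable[ℱ t] (w t))
    (hghat_meas : ∀ t, Measurable (ghat t))
    (hghat_int : ∀ t, Integrable (ghat t) μ)
    (hghat_sq_int : ∀ t, Integrable (fun ω => ‖ghat t ω‖ ^ 2) μ)
    (hunbiased : ∀ t, 1 ≤ t →
      μ[ghat t | ℱ t] =ᵐ[μ] fun ω => gradient ℓ (w t ω))
    (G : ℕ → ℝ)
    (hG : ∀ t, 1 ≤ t →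
      ∀ᵐ ω ∂μ, (μ[fun ω' => ‖ghat t ω'‖ ^ 2 | ℱ t]) ω ≤ (G t) ^ 2) :
    ∀ T, 1 ≤ T →
      ∫ ω, ‖w (T + 1) ω - wstar‖ ^ 2 ∂μ ≤
        (4 / (lam ^ 2 * (T : ℝ) ^ 2)) * ∑ t ∈ Finset.Icc 1 T, (G t) ^ 2 := by
  have hghat2 (t : ℕ) : MemLp (ghat t) 2 μ :=
    (memLp_two_iff_integrable_sq_norm (hghat_meas t).aestronglyMeasurable).2 (hghat_sq_int t)
  have hupdate' (t : ℕ) (ht : 1 ≤ t) (ω : Ω) :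
      w (t + 1) ω - wstar = (w t ω - wstar) - (1 / (lam * t)) • ghat t ω := by
    rw [hupdate t ht ω, sub_right_comm]
  have hw2 (t : ℕ) (ht : 1 ≤ t) : MemLp (fun ω => w t ω - wstar) 2 μ := by
    induction t, ht using Nat.le_induction with
    | base => simpa only [hw₁] using memLp_const (w₁ - wstar)
    | succ t ht ih =>
      simp only [hupdate' t ht]
      exact ih.sub ((hghat2 t).const_smul (1 / (lam * t : ℝ)))
  have hstep (t : ℕ) (ht : 1 ≤ t) := by
    have halign : ∀ᵐ ω ∂μ, lam * ‖w t ω - wstar‖ ^ 2 ≤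
        ⟪w t ω - wstar, (μ[ghat t | ℱ t]) ω⟫ := by
      filter_upwards [hunbiased t ht] with ω hω
      rw [hω]
      exact mul_norm_sub_sq_le_inner_gradient hsc hmin _
    have h := integral_norm_sub_smul_sq_le (ℱ.le t) (f := fun ω => w t ω - wstar)
      ((hadapted t ht).sub stronglyMeasurable_const) (hw2 t ht) (hghat2 t)
      (η := 1 / (lam * t)) (by positivity) halign (hG t ht)
    simpa only [← hupdate' t ht] using h
  have hsum (T : ℕ) : lam ^ 2 * (T : ℝ) ^ 2 * ∫ ω, ‖w (T + 1) ω - wstar‖ ^ 2 ∂μ ≤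
      ∑ t ∈ Finset.Icc 1 T, (G t) ^ 2 := by
    induction T with
    | zero => simp
    | succ n ih =>
      rw [Finset.sum_Icc_succ_top (by lia)]
      have h := hstep (n + 1) (by lia)
      have hD : 0 ≤ ∫ ω, ‖w (n + 1) ω - wstar‖ ^ 2 ∂μ := integral_nonneg fun _ => by positivity
      set D := ∫ ω, ‖w (n + 1) ω - wstar‖ ^ 2 ∂μ
      push_cast at h ⊢
      calc lam ^ 2 * ((n : ℝ) + 1) ^ 2 * ∫ ω, ‖w (n + 1 + 1) ω - wstar‖ ^ 2 ∂μ
          ≤ lam ^ 2 * ((n : ℝ) + 1) ^ 2 * ((1 - 2 * (1 / (lam * (n + 1))) * lam) * D +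
              (1 / (lam * (n + 1))) ^ 2 * G (n + 1) ^ 2) := by gcongr
        _ = lam ^ 2 * (n : ℝ) ^ 2 * D - lam ^ 2 * D + G (n + 1) ^ 2 := by
          field_simp
          ring
        _ ≤ ∑ t ∈ Finset.Icc 1 n, (G t) ^ 2 + G (n + 1) ^ 2 := by
          have := mul_nonneg (sq_nonneg lam) hD
          linarith
  intro T hT
  have hpos : 0 < lam ^ 2 * (T : ℝ) ^ 2 := by positivity
  have hnonneg : 0 ≤ ∑ t ∈ Finset.Icc 1 T, (G t) ^ 2 := Finset.sum_nonneg fun _ _ => sq_nonneg _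
  rw [div_mul_eq_mul_div, le_div_iff₀ hpos, mul_comm]
  linarith [hsum T]
end
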